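/- For each p ∈ (1,2) and each α ∈ (0,1) there exists a constant C(p,α) > 0, depending only on p and α and independent of the dimension d ∈ ℤ_+, such that for all d ∈ ℤ_+, all t ≥ 16, all w > 0 and all f ∈ ℓ^p(ℤ^d) one has ‖ G_{t+w} f − G_t f ‖_{ℓ^p(ℤ^d)} ≤ C(p,α) · (w/t)^α · ‖f‖_{ℓ^p(ℤ^d)}. -/

import Mathlib

open scoped ENNReal Real BigOperators
open Real

/-- The one-dimensional Theta function `θ_t(ζ) = Σ_{k∈ℤ} exp(-π(k-ζ)²t)`. -/
noncomputable def theta (t ζ : ℝ) : ℝ :=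
  ∑' k : ℤ, Real.exp (-π * ((k : ℝ) - ζ) ^ 2 * t)

/-- The d-dimensional Theta function `Θ_t(ξ) = Π_j θ_t(ξ_j)`. -/
noncomputable def bigTheta (d : ℕ) (t : ℝ) (ξ : Fin d → ℝ) : ℝ :=
  ∏ j, theta t (ξ j)

/-- The discrete normalized Gaussian kernel `g_t(n) = Θ_{1/t}(0)⁻¹ exp(-π|n|²/t)`. -/
noncomputable def gauss (d : ℕ) (t : ℝ) (n : Fin d → ℤ) : ℝ :=
  (bigTheta d (1 / t) 0)⁻¹ * Real.exp (-π * (∑ j, ((n j : ℝ)) ^ 2) / t)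

/-- The convolution operator `G_t f(x) = Σ_n g_t(n) f(x-n)` on ℤ^d. -/
noncomputable def gConv (d : ℕ) (t : ℝ) (f : (Fin d → ℤ) → ℂ) (x : Fin d → ℤ) : ℂ :=
  ∑' n : Fin d → ℤ, (gauss d t n : ℂ) * f (x - n)

/-- The ℓ^p norm (valued in ℝ≥0∞) of an ℝ≥0∞-valued function on ℤ^d. -/
noncomputable def lpNorm (d : ℕ) (p : ℝ) (F : (Fin d → ℤ) → ℝ≥0∞) : ℝ≥0∞ :=
  (∑' x : Fin d → ℤ, F x ^ p) ^ (1 / p)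

section Marchaud
variable {E : Type*} [NormedAddCommGroup E]

lemma fd_bound (t h B : ℝ) (hh : 0 ≤ h) (G : ℝ → E) (hB : ∀ s, t ≤ s → ‖G s‖ ≤ B) (m : ℕ) :
    ∀ s, t ≤ s → ‖(fwdDiff h)^[m] G s‖ ≤ 2 ^ m * B := by
  induction m with
  | zero => simpa using hB
  | succ m ih =>
    intro s hs
    rw [Function.iterate_succ_apply', fwdDiff]
    have h1 := ih (s + h) (by linarith)
    have h2 := ih s hs
    calc _ ≤ _ := norm_sub_le _ _
      _ ≤ 2 ^ m * B + 2 ^ m * B := add_le_add h1 h2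
      _ = _ := by ring

lemma fd_two_le (t h : ℝ) (hh : 0 ≤ h) (i : ℕ) : ∀ (Y : ℝ → E) (D : ℝ),
    (∀ s, t ≤ s → ‖(fwdDiff h)^[i] Y s‖ ≤ D) →
    ∀ s, t ≤ s → ‖(fwdDiff (2 * h))^[i] Y s‖ ≤ 2 ^ i * D := by
  induction i with
  | zero => intro Y D hD; simpa using hD
  | succ i ih =>
    intro Y D hD
    have key : fwdDiff (2 * h) Y = (fun s => Y (s + h + h) - Y s) := by
      funext s; simp only [fwdDiff]; congr 2; ring
    have key2 : fwdDiff (2 * h) Y = (fun s => fwdDiff h Y (s + h)) + fwdDiff h Y := by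
      rw [key]; funext s; simp [fwdDiff]
    intro s hs
    rw [Function.iterate_succ_apply, key2]
    have := ih ((fun s => fwdDiff h Y (s + h)) + fwdDiff h Y) (2 * D) (by
      intro s hs
      rw [fwdDiff_iter_add, Pi.add_apply]
      have e1 : (fwdDiff h)^[i] (fun s => fwdDiff h Y (s + h)) s = (fwdDiff h)^[i+1] Y (s + h) := by
        rw [Function.iterate_succ_apply]
        exact fwdDiff_iter_comp_add (h := h) (fwdDiff h Y) h i s
      have e2 : (fwdDiff h)^[i] (fwdDiff h Y) s = (fwdDiff h)^[i+1] Y s := by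
        rw [Function.iterate_succ_apply]
      rw [e1, e2]
      calc _ ≤ _ := norm_add_le _ _
        _ ≤ D + D := add_le_add (hD _ (by linarith)) (hD _ hs)
        _ = 2 * D := by ring) s hs
    calc _ ≤ _ := this
      _ = _ := by ring

lemma fd_two_sub (t h : ℝ) (hh : 0 ≤ h) (i : ℕ) : ∀ (G : ℝ → E) (D : ℝ),
    (∀ s, t ≤ s → ‖(fwdDiff h)^[i + 1] G s‖ ≤ D) →
    ∀ s, t ≤ s → ‖(fwdDiff (2 * h))^[i] G s - (2:ℕ) ^ i • (fwdDiff h)^[i] G s‖ ≤ i * 2 ^ i * D := by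
  induction i with
  | zero => intro G D hD s hs; simp
  | succ i ih =>
    intro G D hD s hs
    have hD0 : 0 ≤ D := (norm_nonneg _).trans (hD s hs)
    have key : fwdDiff (2 * h) G = fwdDiff h G + (fwdDiff h G + fwdDiff h (fwdDiff h G)) := by
      funext s; simp only [fwdDiff, Pi.add_apply]
      have : s + 2 * h = s + h + h := by ring
      rw [this]; abel
    have h1 := ih (fwdDiff h G) D (by
      intro s hs; simpa only [Function.iterate_succ_apply] using hD s hs) s hs
    have h2 := fd_two_le t h hh i (fwdDiff h (fwdDiff h G)) D (by
      intro s hs; simpa only [Function.iterate_succ_apply] using hD s hs) s hs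
    rw [Function.iterate_succ_apply, Function.iterate_succ_apply, key, fwdDiff_iter_add,
      fwdDiff_iter_add, Pi.add_apply, Pi.add_apply]
    set a := (fwdDiff (2 * h))^[i] (fwdDiff h G) s
    set b := (fwdDiff h)^[i] (fwdDiff h G) s
    set c := (fwdDiff (2 * h))^[i] (fwdDiff h (fwdDiff h G)) s
    have e : a + (a + c) - 2 ^ (i + 1) • b = (a - 2 ^ i • b) + (a - 2 ^ i • b) + c := by
      rw [pow_succ, mul_comm, two_mul, add_smul]; abel
    rw [e]
    calc _ ≤ ‖a - 2 ^ i • b‖ + ‖a - 2 ^ i • b‖ + ‖c‖ := norm_add₃_le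
      _ ≤ i * 2 ^ i * D + i * 2 ^ i * D + 2 ^ i * D := by gcongr
      _ ≤ _ := by
        push_cast
        have : 0 ≤ 2 ^ i * D := by positivity
        rw [pow_succ]; nlinarith

lemma marchaud_step (α : ℝ) (hα1 : α < 1) (m : ℕ) (hm : 1 ≤ m) :
    ∃ C : ℝ, 0 < C ∧ ∀ (E : Type) [NormedAddCommGroup E] [NormedSpace ℝ E] (F : ℝ → E) (t B D : ℝ), 0 ≤ D →
    (∀ s, t ≤ s → ‖F s‖ ≤ B) →
    (∀ s, t ≤ s → ∀ h, 0 < h → ‖(fwdDiff h)^[m + 1] F s‖ ≤ D * h ^ α) →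
    (∀ s, t ≤ s → ∀ h, 0 < h → ‖(fwdDiff h)^[m] F s‖ ≤ C * D * h ^ α) := by
  have hα : (2:ℝ) ^ (α - 1) < 1 := Real.rpow_lt_one_of_one_lt_of_neg (by norm_num) (by linarith)
  have hα' : (0:ℝ) < 1 - 2 ^ (α - 1) := by linarith
  have hm' : (1:ℝ) ≤ m := by exact_mod_cast hm
  refine ⟨m / (1 - 2 ^ (α - 1)), by positivity, ?_⟩
  intro E _ _ F t B D hD hB hF s hs
  set C := m / (1 - (2:ℝ) ^ (α - 1)) with hC
  have hC0 : 0 < C := by positivity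
  have hCe : C * 2 ^ (α - 1) + m = C := by
    rw [hC]; field_simp; ring
  have hB0 : 0 ≤ B := (norm_nonneg _).trans (hB s hs)
  have hrec (h : ℝ) (hh : 0 < h) :
      ‖(fwdDiff h)^[m] F s‖ ≤ 2⁻¹ * ‖(fwdDiff (2 * h))^[m] F s‖ + m * (D * h ^ α) := by
    have h1 := fd_two_sub t h hh.le m F (D * h ^ α)
      (fun s hs => hF s hs h hh) s hs
    set a := (fwdDiff (2 * h))^[m] F s
    set b := (fwdDiff h)^[m] F s
    have h2 : ‖((2:ℕ)^m) • b‖ ≤ ‖a‖ + m * 2 ^ m * (D * h ^ α) := by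
      have := norm_sub_norm_le ((2:ℕ)^m • b) a
      rw [norm_sub_rev] at this
      linarith
    have h3 : ‖((2:ℕ)^m) • b‖ = 2 ^ m * ‖b‖ := by
      rw [← Nat.cast_smul_eq_nsmul ℝ, norm_smul]; simp
    rw [h3] at h2
    have h4 : (2:ℝ) ≤ 2 ^ m := by
      calc (2:ℝ) = 2 ^ 1 := by norm_num
        _ ≤ _ := pow_le_pow_right₀ (by norm_num) hm
    have h5 : ‖b‖ ≤ (2^m)⁻¹ * ‖a‖ + m * (D * h ^ α) := by
      have : ‖b‖ = (2^m)⁻¹ * (2 ^ m * ‖b‖) := by field_simp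
      rw [this]
      calc _ ≤ (2^m)⁻¹ * (‖a‖ + m * 2 ^ m * (D * h ^ α)) := by gcongr
        _ = _ := by field_simp
    refine h5.trans ?_
    gcongr
  have hmain (J : ℕ) : ∀ h, 0 < h →
      ‖(fwdDiff h)^[m] F s‖ ≤ (2⁻¹) ^ J * (2 ^ m * B) + C * D * h ^ α := by
    induction J with
    | zero =>
      intro h hh
      have := fd_bound t h B hh.le F hB m s hs
      have h2 : 0 ≤ C * D * h ^ α := by positivity
      simp only [pow_zero, one_mul]; linarith
    | succ J ih =>
      intro h hh
      have h1 := hrec h hh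
      have h2 := ih (2 * h) (by positivity)
      rw [Real.mul_rpow (by norm_num) hh.le] at h2
      have e : (2:ℝ) ^ α = 2 * 2 ^ (α - 1) := by
        rw [Real.rpow_sub_one (by norm_num)]; ring
      calc _ ≤ 2⁻¹ * ((2⁻¹) ^ J * (2 ^ m * B) + C * D * (2 ^ α * h ^ α)) + m * (D * h ^ α) := by
            linarith
        _ = (2⁻¹) ^ (J+1) * (2 ^ m * B) + (C * 2 ^ (α - 1) + m) * D * h ^ α := by
            rw [e]; ring
        _ = _ := by rw [hCe]
  intro h hh
  have lim : Filter.Tendsto (fun J : ℕ => ((2:ℝ)⁻¹) ^ J * (2 ^ m * B) + C * D * h ^ α) Filter.atTop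
      (nhds (0 * (2 ^ m * B) + C * D * h ^ α)) := by
    apply Filter.Tendsto.add_const
    apply Filter.Tendsto.mul_const
    exact tendsto_pow_atTop_nhds_zero_of_lt_one (by norm_num) (by norm_num)
  have := ge_of_tendsto' lim (fun J => hmain J h hh)
  simpa using this

lemma marchaud (α : ℝ) (hα1 : α < 1) (m : ℕ) :
    ∃ C : ℝ, 0 < C ∧ ∀ (E : Type) [NormedAddCommGroup E] [NormedSpace ℝ E] (F : ℝ → E) (t B D : ℝ), 0 ≤ D →
    (∀ s, t ≤ s → ‖F s‖ ≤ B) →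
    (∀ s, t ≤ s → ∀ h, 0 < h → ‖(fwdDiff h)^[m + 1] F s‖ ≤ D * h ^ α) →
    (∀ s, t ≤ s → ∀ h, 0 < h → ‖F (s + h) - F s‖ ≤ C * D * h ^ α) := by
  induction m with
  | zero =>
    refine ⟨1, one_pos, ?_⟩
    intro E _ _ F t B D hD hB hF s hs h hh
    simpa [fwdDiff] using hF s hs h hh
  | succ m ih =>
    obtain ⟨C, hC, H⟩ := ih
    obtain ⟨C', hC', H'⟩ := marchaud_step α hα1 (m + 1) (by omega)
    refine ⟨C * C', by positivity, ?_⟩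
    intro E _ _ F t B D hD hB hF s hs h hh
    have := H E F t B (C' * D) (by positivity) hB (H' E F t B D hD hB hF) s hs h hh
    calc _ ≤ _ := this
      _ = _ := by ring

end Marchaud

lemma holo_diff (k : ℕ) : ∀ (F : ℂ → ℂ) (t R M w : ℝ), 0 < R → 0 ≤ M → 0 ≤ w →
    (∀ z : ℂ, t - R < z.re → |z.im| < R → DifferentiableAt ℂ F z) →
    (∀ z : ℂ, t - R < z.re → |z.im| < R → ‖F z‖ ≤ M) →
    ∀ s : ℝ, t ≤ s → ‖(fwdDiff (w : ℂ))^[k] F s‖ ≤ M * (4 ^ (k ^ 2) * (w / R) ^ k) := by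
  induction k with
  | zero => 
    intro F t R M w hR hM hw hd hb s hs
    simpa using hb s (by simp; linarith) (by simpa using hR)
  | succ k ih =>
    intro F t R M w hR hM hw hd hb s hs
    rw [Function.iterate_succ_apply]
    have hder : ∀ z : ℂ, t - R / 2 < z.re → |z.im| < R / 2 → ‖deriv F z‖ ≤ M / (R / 4) := by
      intro z h1 h2
      have hin : ∀ y ∈ Metric.closedBall z (R / 4), t - R < y.re ∧ |y.im| < R := by
        intro y hy
        rw [Metric.mem_closedBall, dist_eq_norm] at hy
        have h3 := (Complex.abs_re_le_norm (y - z)).trans hy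
        have h4 := (Complex.abs_im_le_norm (y - z)).trans hy
        rw [Complex.sub_re, abs_le] at h3
        rw [Complex.sub_im, abs_le] at h4
        rw [abs_lt] at h2 ⊢
        refine ⟨by linarith, by linarith, by linarith⟩
      apply Complex.norm_deriv_le_of_forall_mem_sphere_norm_le (by positivity)
      · apply DifferentiableOn.diffContOnCl
        intro y hy
        have hy' := hin y (Metric.closure_ball_subset_closedBall hy)
        exact (hd y hy'.1 hy'.2).differentiableWithinAt
      · intro y hy
        have hy' := hin y (Metric.sphere_subset_closedBall hy)
        exact hb y hy'.1 hy'.2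
    have := ih (fwdDiff (w : ℂ) F) t (R / 2) (M / (R / 4) * w) w (by positivity) (by positivity) hw
      (by
        intro z h1 h2
        have h1' : t - R < z.re := by linarith
        have h2' : |z.im| < R := by linarith
        unfold fwdDiff
        apply DifferentiableAt.sub _ (hd z h1' h2')
        have : DifferentiableAt ℂ F (z + w) := hd _ (by simp; linarith) (by simpa using h2')
        exact differentiableAt_comp_add_const.2 this)
      (by
        intro z h1 h2
        let V : Set ℂ := {z : ℂ | t - R / 2 < z.re} ∩ {z : ℂ | |z.im| < R / 2}
        have hV : Convex ℝ V := by
          apply (convex_halfSpace_re_gt _).inter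
          have : {z : ℂ | |z.im| < R / 2} = {z : ℂ | z.im < R / 2} ∩ {z : ℂ | -(R/2) < z.im} := by
            ext z; simp [abs_lt, and_comm]
          rw [this]
          exact (convex_halfSpace_im_lt _).inter (convex_halfSpace_im_gt _)
        have := hV.norm_image_sub_le_of_norm_deriv_le (𝕜 := ℂ) (f := F) (C := M / (R / 4)) (x := z)
          (y := z + w) (fun x hx => hd x (by have := hx.1; simp at this; linarith)
            (by have := hx.2; simp at this; linarith))
          (fun x hx => hder x hx.1 hx.2) ⟨h1, h2⟩ ⟨by simp; linarith, by simpa using h2⟩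
        simpa [fwdDiff, abs_of_nonneg hw] using this) s hs
    refine this.trans ?_
    have e : M / (R / 4) * w * (4 ^ k ^ 2 * (w / (R / 2)) ^ k) =
      M * ((4 ^ (k^2) * 2 ^ k * 4) * (w / R) ^ (k+1)) := by
      have : w / (R / 2) = 2 * (w / R) := by field_simp
      rw [this, mul_pow, pow_succ (w / R)]; field_simp
    rw [e]
    gcongr
    have : (4:ℝ) ^ ((k+1)^2) = 4 ^ (k^2) * (4 ^ (2 * k)) * 4 := by ring
    rw [this]
    gcongr
    rw [pow_mul]
    gcongr
    norm_num

section ThetaPart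
open Complex

noncomputable def cth (s : ℂ) (x : ℝ) : ℂ := ∑' k : ℤ, cexp (-π * ((k : ℂ) - x) ^ 2 * s)

lemma cth_term (s : ℂ) (x : ℝ) (k : ℤ) : cexp (-π * ((k : ℂ) - x) ^ 2 * s) =
    cexp (-π * (x:ℂ) ^ 2 * s) * jacobiTheta₂_term k (-I * x * s) (I * s) := by
  rw [jacobiTheta₂_term, ← Complex.exp_add]
  congr 1
  have : I * I = -1 := I_mul_I
  linear_combination (2 * π * k * x * s - π * (k:ℂ) ^ 2 * s) * this

lemma cth_summable {s : ℂ} (hs : 0 < s.re) (x : ℝ) :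
    Summable (fun k : ℤ => cexp (-π * ((k : ℂ) - x) ^ 2 * s)) := by
  simp_rw [cth_term]
  apply Summable.mul_left
  rw [summable_jacobiTheta₂_term_iff]
  simpa using hs

lemma cth_eq (s : ℂ) (x : ℝ) :
    cth s x = cexp (-π * (x:ℂ) ^ 2 * s) * jacobiTheta₂ (-I * x * s) (I * s) := by
  unfold cth jacobiTheta₂
  simp_rw [cth_term]
  rw [tsum_mul_left]

lemma cth_diff {s : ℂ} (hs : 0 < s.re) (x : ℝ) : DifferentiableAt ℂ (fun s => cth s x) s := by
  simp_rw [cth_eq]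
  apply DifferentiableAt.mul
  · fun_prop
  · have h := (hasFDerivAt_jacobiTheta₂ (-I * x * s) (τ := I * s) (by simpa using hs)).differentiableAt
    have h2 : DifferentiableAt ℂ (fun s : ℂ => ((-I * x * s, I * s) : ℂ × ℂ)) s := by fun_prop
    exact DifferentiableAt.comp (f := fun s : ℂ => ((-I * x * s, I * s) : ℂ × ℂ))
      (g := fun p : ℂ × ℂ ↦ jacobiTheta₂ p.1 p.2) s h h2

lemma cth_period (s : ℂ) (x : ℝ) (m : ℤ) : cth s (x - m) = cth s x := by
  unfold cth
  rw [← (Equiv.addRight m).tsum_eq (fun k : ℤ => cexp (-π * ((k : ℂ) - x) ^ 2 * s))]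
  apply tsum_congr
  intro k
  congr 3
  simp; ring

lemma geom_hasSum {r : ℝ} (h0 : 0 ≤ r) (h1 : r < 1) :
    HasSum (fun k : ℤ => r ^ k.natAbs) ((1 - r)⁻¹ + r * (1 - r)⁻¹) := by
  apply HasSum.of_nat_of_neg_add_one
  · simpa using hasSum_geometric_of_lt_one h0 h1
  · have : ∀ n : ℕ, r ^ (-((n:ℤ) + 1)).natAbs = r * r ^ n := by
      intro n
      rw [Int.natAbs_neg, ← pow_succ']
      rfl
    simp_rw [this]
    exact (hasSum_geometric_of_lt_one h0 h1).mul_left r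

lemma tail_bound (a : ℤ → ℂ) (c : ℝ) (hc : 0 ≤ c) (ha : ∀ k ≠ 0, ‖a k‖ ≤ c * (1 / 300 : ℝ) ^ k.natAbs) :
    ‖∑' k, a k - a 0‖ ≤ c / 100 := by
  have hg := geom_hasSum (r := 1 / 300) (by norm_num) (by norm_num)
  have hg2 : HasSum (fun k : ℤ => c * (if k = 0 then 0 else (1 / 300 : ℝ) ^ k.natAbs)) (c * ((1 - 1/300)⁻¹ + 1/300 * (1 - 1/300)⁻¹ - 1)) := by
    apply HasSum.mul_left
    have := hg.update 0 0
    have e1 : (fun k : ℤ => if k = 0 then 0 else (1 / 300 : ℝ) ^ k.natAbs) =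
        Function.update (fun k : ℤ => (1 / 300 : ℝ) ^ k.natAbs) 0 0 := by
      funext k
      by_cases hk : k = 0
      · simp [hk]
      · simp [hk]
    have e2 : ((1 - 1/300 : ℝ)⁻¹ + 1/300 * (1 - 1/300)⁻¹ - 1) =
      0 - (1 / 300) ^ Int.natAbs 0 + ((1 - 1 / 300)⁻¹ + 1 / 300 * (1 - 1 / 300)⁻¹) := by
      simp; ring
    rw [e1, e2]
    exact this
  have hb : ∀ k, ‖Function.update a 0 0 k‖ ≤ c * (if k = 0 then 0 else (1 / 300 : ℝ) ^ k.natAbs) := by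
    intro k
    by_cases hk : k = 0
    · simp [hk]
    · simpa [hk] using ha k hk
  have hs : Summable (Function.update a 0 0) := Summable.of_norm_bounded hg2.summable hb
  have h1 := hs.hasSum.update 0 (a 0)
  simp at h1
  rw [h1.tsum_eq]
  simp only [add_sub_cancel_left]
  refine (tsum_of_norm_bounded hg2 hb).trans ?_
  have : ((1 - 1/300 : ℝ)⁻¹ + 1/300 * (1 - 1/300)⁻¹ - 1) ≤ 1 / 100 := by norm_num
  nlinarith

lemma exp_six (n : ℕ) {y : ℝ} (h : y ≤ -6 * n) : rexp y ≤ (1 / 300 : ℝ) ^ n := by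
  have h6 : rexp (-6) ≤ 1 / 300 := by
    rw [Real.exp_neg, one_div]
    apply inv_anti₀ (by norm_num)
    have : rexp 6 = rexp 1 ^ 6 := by rw [← Real.exp_nat_mul]; norm_num
    rw [this]
    calc (300:ℝ) ≤ 2.7 ^ 6 := by norm_num
      _ ≤ _ := by gcongr; linarith [Real.exp_one_gt_d9]
  calc _ ≤ rexp (n * (-6)) := by apply Real.exp_le_exp.2; linarith
    _ = rexp (-6) ^ n := by rw [Real.exp_nat_mul]
    _ ≤ _ := by gcongr

lemma term_norm (s : ℂ) (y : ℝ) : ‖cexp (-π * (y:ℂ) ^ 2 * s)‖ = rexp (-π * y ^ 2 * s.re) := by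
  rw [Complex.norm_exp]
  have : (-π * (y:ℂ) ^ 2 * s) = ((-π * y ^ 2 : ℝ) : ℂ) * s := by push_cast; ring
  rw [this, re_ofReal_mul]

lemma abs_natAbs (k : ℤ) : ((k.natAbs : ℕ) : ℝ) = |(k:ℝ)| := by
  rw [Nat.cast_natAbs]; simp

lemma one_le_abs {k : ℤ} (hk : k ≠ 0) : 1 ≤ |(k:ℝ)| := by
  have := Int.one_le_abs hk
  exact_mod_cast this

lemma cth_tail {s : ℂ} (hs : 12 ≤ s.re) {x : ℝ} (hx : |x| ≤ 1 / 2) :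
    ‖cth s x - cexp (-π * (x:ℂ) ^ 2 * s)‖ ≤ 1 / 100 := by
  have := tail_bound (fun k : ℤ => cexp (-π * ((k : ℂ) - x) ^ 2 * s)) 1 (by norm_num) (by
    intro k hk
    have e : ((k:ℂ) - x) = ((k - x : ℝ) : ℂ) := by push_cast; ring
    rw [e, term_norm, one_mul]
    apply exp_six
    rw [abs_natAbs]
    have h1 := one_le_abs hk
    have h2 : |(k:ℝ)| / 2 ≤ |(k:ℝ) - x| := by
      have := abs_sub_abs_le_abs_sub (k:ℝ) x
      linarith
    have h3 : |(k:ℝ)| / 4 ≤ ((k:ℝ) - x) ^ 2 := by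
      rw [← sq_abs]; nlinarith
    have h4 : 3 * (|(k:ℝ)| / 4) * 12 ≤ π * ((k:ℝ) - x) ^ 2 * s.re := by
      have := Real.pi_gt_three
      gcongr
    linarith)
  simpa [cth] using this

lemma cth_zero_near {s : ℂ} (hs : 12 ≤ s.re) : ‖cth s 0 - 1‖ ≤ 1 / 100 := by
  simpa using cth_tail hs (x := 0) (by norm_num)

lemma cth_zero_ge {s : ℂ} (hs : 12 ≤ s.re) : 99 / 100 ≤ ‖cth s 0‖ := by
  have h := cth_zero_near hs
  have := norm_sub_norm_le (1:ℂ) (cth s 0)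
  rw [norm_sub_rev, norm_one] at this
  linarith

lemma cosh_sub_one_norm (u : ℂ) : ‖Complex.cosh u - 1‖ ≤ ‖u‖ ^ 2 * rexp ‖u‖ := by
  have h1 := norm_exp_sub_sum_le_norm_mul_exp u 2
  have h2 := norm_exp_sub_sum_le_norm_mul_exp (-u) 2
  simp [Finset.sum_range_succ] at h1 h2
  have e : Complex.cosh u - 1 = ((cexp u - (1 + u)) + (cexp (-u) - (1 + -u))) / 2 := by
    rw [Complex.cosh]; ring
  rw [e, norm_div]
  have := norm_add_le (cexp u - (1 + u)) (cexp (-u) - (1 + -u))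
  simp only [Complex.norm_ofNat]
  linarith

lemma cth_cosh {s : ℂ} (hs : 0 < s.re) (x : ℝ) :
    HasSum (fun k : ℤ => cexp (-π * (k:ℂ) ^ 2 * s) * Complex.cosh (2 * π * k * x * s))
      (cexp (π * (x:ℂ) ^ 2 * s) * cth s x) := by
  have h1 : HasSum (fun k : ℤ => cexp (-π * ((k : ℂ) - x) ^ 2 * s)) (cth s x) := (cth_summable hs x).hasSum
  have h2 := (Equiv.neg ℤ).hasSum_iff.2 h1
  have h3 := (h1.add h2).mul_left (cexp (π * (x:ℂ) ^ 2 * s) / 2)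
  have e2 : cexp (π * (x:ℂ) ^ 2 * s) / 2 * (cth s x + cth s x) =
      cexp (π * (x:ℂ) ^ 2 * s) * cth s x := by ring
  rw [e2] at h3
  refine h3.congr_fun ?_
  · intro k
    simp only [Function.comp, Equiv.neg_apply, Complex.cosh]
    rw [mul_add, mul_div_assoc', mul_add, add_div, div_mul_eq_mul_div, div_mul_eq_mul_div,
      ← Complex.exp_add, ← Complex.exp_add, ← Complex.exp_add, ← Complex.exp_add]
    congr 3 <;> (push_cast; ring_nf)

lemma cth_le_small {s : ℂ} (hs : 12 ≤ s.re) (hs2 : ‖s‖ ≤ 4 / 3 * s.re) {x : ℝ} (hx : |x| ≤ 1 / 4) :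
    ‖cth s x‖ ≤ ‖cth s 0‖ := by
  have hs0 : 0 < s.re := by linarith
  have hN := cth_cosh hs0 x
  have hD := (cth_summable hs0 0).hasSum
  simp only [ofReal_zero, sub_zero] at hD
  have hd := hN.sub hD
  have hpi := Real.pi_gt_three
  have hpi4 := Real.pi_lt_d2
  set σ := s.re
  have tb := tail_bound (c := 64 / 9 * π ^ 2 * x ^ 2 * σ) (hc := by positivity) (a := fun k : ℤ =>
    cexp (-π * (k:ℂ) ^ 2 * s) * Complex.cosh (2 * π * k * x * s) - cexp (-π * (k:ℂ) ^ 2 * s)) (ha := by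
    intro k hk
    have h1 := one_le_abs hk
    have e : cexp (-π * (k:ℂ) ^ 2 * s) * Complex.cosh (2 * π * k * x * s) - cexp (-π * (k:ℂ) ^ 2 * s)
      = cexp (-π * ((k:ℝ):ℂ) ^ 2 * s) * (Complex.cosh (2 * π * k * x * s) - 1) := by push_cast; ring
    rw [e, norm_mul, term_norm]
    have hu : ‖(2 * π * k * x * s : ℂ)‖ = 2 * π * |(k:ℝ)| * |x| * ‖s‖ := by
      simp [abs_of_pos Real.pi_pos]
    have hc := cosh_sub_one_norm (2 * π * k * x * s)
    rw [hu] at hc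
    have k2 : |(k:ℝ)| ≤ (k:ℝ) ^ 2 := by rw [← sq_abs]; nlinarith
    set K := (k:ℝ) ^ 2 with hK
    have hK1 : 1 ≤ K := h1.trans k2
    have b1 : (2 * π * |(k:ℝ)| * |x| * ‖s‖) ^ 2 ≤ 64 / 9 * π ^ 2 * x ^ 2 * σ * (σ * K) := by
      calc (2 * π * |(k:ℝ)| * |x| * ‖s‖) ^ 2 = 4 * π ^ 2 * x ^ 2 * K * ‖s‖ ^ 2 := by
            rw [← sq_abs x, hK, ← sq_abs (k:ℝ)]; ring
        _ ≤ 4 * π ^ 2 * x ^ 2 * K * (4 / 3 * σ) ^ 2 := by gcongr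
        _ = _ := by ring
    have b2 : 2 * π * |(k:ℝ)| * |x| * ‖s‖ ≤ 2 / 3 * π * σ * K := by
      calc _ ≤ 2 * π * K * (1 / 4) * (4 / 3 * σ) := by gcongr
        _ = _ := by ring
    have b3 : σ * K ≤ rexp (σ * K / 2) := by
      have h := Real.add_one_le_exp (σ * K / 4)
      have e2 : rexp (σ * K / 2) = rexp (σ * K / 4) ^ 2 := by
        rw [← Real.exp_nat_mul]; congr 1; push_cast; ring
      have h0 : 0 ≤ σ * K := by positivity
      rw [e2]
      nlinarith [sq_nonneg (σ * K / 4 - 1)]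
    have fin : rexp (-π * K * σ) * (rexp (σ * K / 2) * rexp (2 / 3 * π * σ * K)) ≤ (1 / 300) ^ k.natAbs := by
      rw [← Real.exp_add, ← Real.exp_add]
      apply exp_six
      rw [abs_natAbs]
      have h5 : 3 * (σ * K) ≤ π * (σ * K) := by gcongr
      have h6 : 12 * |(k:ℝ)| ≤ σ * K := by gcongr
      nlinarith
    calc _ ≤ rexp (-π * K * σ) * ((64 / 9 * π ^ 2 * x ^ 2 * σ * rexp (σ * K / 2)) * rexp (2 / 3 * π * σ * K)) := by
          gcongr
          refine hc.trans ?_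
          gcongr
          exact b1.trans (by gcongr)
      _ = 64 / 9 * π ^ 2 * x ^ 2 * σ * (rexp (-π * K * σ) * (rexp (σ * K / 2) * rexp (2 / 3 * π * σ * K))) := by ring
      _ ≤ _ := by gcongr)
  rw [hd.tsum_eq] at tb
  simp only [Int.cast_zero, mul_zero, zero_mul, Complex.cosh_zero, mul_one, sub_self, sub_zero] at tb
  have e0 : (∑' k : ℤ, cexp (-π * (k:ℂ) ^ 2 * s)) = cth s 0 := by simp [cth]
  rw [e0] at tb
  have hge := cth_zero_ge hs
  set D := ‖cth s 0‖
  have hx2 : 0 ≤ π * x ^ 2 * σ := by positivity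
  have n1 : ‖cexp (π * (x:ℂ) ^ 2 * s)‖ = rexp (π * x ^ 2 * σ) := by
    rw [Complex.norm_exp]
    have : (π * (x:ℂ) ^ 2 * s) = ((π * x ^ 2 : ℝ) : ℂ) * s := by push_cast; ring
    rw [this, re_ofReal_mul]
  have n2 : rexp (π * x ^ 2 * σ) * ‖cth s x‖ ≤ D + 64 / 9 * π ^ 2 * x ^ 2 * σ / 100 := by
    rw [← n1, ← norm_mul]
    have := norm_sub_norm_le (cexp (π * (x:ℂ) ^ 2 * s) * cth s x) (cth s 0)
    linarith
  have n3 : D + 64 / 9 * π ^ 2 * x ^ 2 * σ / 100 ≤ rexp (π * x ^ 2 * σ) * D := by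
    have h := Real.add_one_le_exp (π * x ^ 2 * σ)
    have : (π * x ^ 2 * σ + 1) * D ≤ rexp (π * x ^ 2 * σ) * D := by gcongr
    have h2 : 64 / 9 * π ^ 2 * x ^ 2 * σ / 100 ≤ (π * x ^ 2 * σ) * D := by
      calc 64 / 9 * π ^ 2 * x ^ 2 * σ / 100 = (π * x ^ 2 * σ) * (64 / 900 * π) := by ring
        _ ≤ _ := by gcongr; linarith
    linarith
  exact le_of_mul_le_mul_left (n2.trans n3) (Real.exp_pos _)

lemma cth_le_large {s : ℂ} (hs : 12 ≤ s.re) {x : ℝ} (hx : |x| ≤ 1 / 2) (hx' : 1 / 4 ≤ |x|) :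
    ‖cth s x‖ ≤ ‖cth s 0‖ := by
  have h1 := cth_tail hs hx
  have h2 := cth_zero_ge hs
  have h3 := norm_sub_norm_le (cth s x) (cexp (-π * (x:ℂ) ^ 2 * s))
  rw [term_norm] at h3
  have h4 : rexp (-π * x ^ 2 * s.re) ≤ 1 / 2 := by
    have hpi := Real.pi_gt_three
    have hx2 : 1 / 16 ≤ x ^ 2 := by rw [← sq_abs]; nlinarith
    have : 3 * (1 / 16) * 12 ≤ π * x ^ 2 * s.re := by gcongr
    calc _ ≤ rexp (-1) := by apply Real.exp_le_exp.2; linarith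
      _ ≤ _ := by
        rw [Real.exp_neg, one_div]; apply inv_anti₀ (by norm_num)
        linarith [Real.exp_one_gt_d9]
  linarith

lemma cth_le {s : ℂ} (hs : 12 ≤ s.re) (hs2 : ‖s‖ ≤ 4 / 3 * s.re) (x : ℝ) :
    ‖cth s x‖ ≤ ‖cth s 0‖ := by
  rw [← cth_period s x (round x)]
  have hx : |x - round x| ≤ 1 / 2 := abs_sub_round x
  rcases le_total |x - round x| (1 / 4) with h | h
  · exact cth_le_small hs hs2 h
  · exact cth_le_large hs hx h

/-- the multiplier -/
noncomputable def mult {d : ℕ} (ξ : Fin d → ℝ) (s : ℂ) : ℂ := ∏ j, (cth s (ξ j) / cth s 0)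

lemma strip_mem {t : ℝ} (ht : 16 ≤ t) {z : ℂ} (h1 : t - t / 4 < z.re) (h2 : |z.im| < t / 4) :
    12 ≤ z.re ∧ ‖z‖ ≤ 4 / 3 * z.re := by
  refine ⟨by linarith, ?_⟩
  have := Complex.norm_le_abs_re_add_abs_im z
  rw [abs_of_nonneg (by linarith : 0 ≤ z.re)] at this
  linarith

lemma mult_le {d : ℕ} (ξ : Fin d → ℝ) {s : ℂ} (hs : 12 ≤ s.re) (hs2 : ‖s‖ ≤ 4 / 3 * s.re) :
    ‖mult ξ s‖ ≤ 1 := by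
  unfold mult
  rw [norm_prod]
  apply Finset.prod_le_one
  · intro i _; positivity
  · intro i _
    rw [norm_div]
    exact div_le_one_of_le₀ (cth_le hs hs2 _) (norm_nonneg _)

lemma mult_diff {d : ℕ} (ξ : Fin d → ℝ) {s : ℂ} (hs : 12 ≤ s.re) :
    DifferentiableAt ℂ (mult ξ) s := by
  unfold mult
  apply DifferentiableAt.fun_finsetProd
  intro i _
  apply DifferentiableAt.div (cth_diff (by linarith) _) (cth_diff (by linarith) _)
  intro h
  have := cth_zero_ge hs
  rw [h, norm_zero] at this
  linarith

lemma poisson {t : ℝ} (ht : 0 < t) (x : ℝ) :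
    ∑' n : ℤ, cexp (-π * (n:ℂ) ^ 2 / t) * cexp (2 * π * I * n * x) =
      1 / (((1 / t : ℝ)) : ℂ) ^ (1 / 2 : ℂ) * cth t x := by
  have h := Complex.tsum_exp_neg_quadratic (a := ((1 / t : ℝ) : ℂ)) (by simpa using ht) (I * x)
  have ht' : (t : ℂ) ≠ 0 := by exact_mod_cast ht.ne'
  calc _ = ∑' n : ℤ, cexp (-π * ((1 / t : ℝ):ℂ) * n ^ 2 + 2 * π * (I * x) * n) := by
        apply tsum_congr; intro n
        rw [← Complex.exp_add]; congr 1; push_cast; ring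
    _ = _ := by
        rw [h]; congr 1
        unfold cth
        apply tsum_congr; intro n
        congr 1
        have : I * (I * x) = -x := by rw [← mul_assoc, I_mul_I]; ring
        rw [this]; push_cast; field_simp; ring

end ThetaPart

section FourierPart
open Complex MeasureTheory

lemma pi_sum (d : ℕ) : ∀ (a : Fin d → ℤ → ℂ), (∀ j, Summable (fun k => ‖a j k‖)) →
    Summable (fun n : Fin d → ℤ => ‖∏ j, a j (n j)‖) ∧
    ∑' n : Fin d → ℤ, ∏ j, a j (n j) = ∏ j, ∑' k, a j k := by
  induction d with
  | zero =>
    intro a _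
    refine ⟨Summable.of_finite, ?_⟩
    simp
  | succ d ih =>
    intro a ha
    obtain ⟨h1, h2⟩ := ih (fun j => a j.succ) (fun j => ha j.succ)
    let e := Fin.consEquiv (fun _ : Fin (d + 1) => ℤ)
    have he : ∀ p : ℤ × (Fin d → ℤ), ∏ j, a j (e p j) = a 0 p.1 * ∏ j : Fin d, a j.succ (p.2 j) := by
      intro p
      rw [Fin.prod_univ_succ]
      rfl
    constructor
    · rw [← e.summable_iff]
      have : ((fun n : Fin (d+1) → ℤ => ‖∏ j, a j (n j)‖) ∘ e) =
          fun p : ℤ × (Fin d → ℤ) => ‖a 0 p.1 * ∏ j : Fin d, a j.succ (p.2 j)‖ := by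
        funext p; simp only [Function.comp]; rw [he]
      rw [this]
      exact summable_mul_of_summable_norm' (ha 0) (Summable.of_norm (ha 0)) h1 (Summable.of_norm h1) |>.norm
    · rw [← e.tsum_eq]
      simp_rw [he]
      rw [Fin.prod_univ_succ, ← h2]
      exact (tsum_mul_tsum_of_summable_norm (ha 0) h1).symm

noncomputable def qq (t : ℝ) (k : ℤ) : ℝ := (theta (1 / t) 0)⁻¹ * Real.exp (-π * (k:ℝ) ^ 2 / t)

lemma gauss_eq (d : ℕ) (t : ℝ) (n : Fin d → ℤ) : gauss d t n = ∏ j, qq t (n j) := by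
  unfold gauss bigTheta qq
  rw [Finset.prod_mul_distrib, ← Finset.prod_inv_distrib, ← Real.exp_sum]
  congr 2
  rw [Finset.mul_sum, Finset.sum_div]

lemma exp_summable {t : ℝ} (ht : 0 < t) : Summable (fun k : ℤ => Real.exp (-π * (k:ℝ) ^ 2 / t)) := by
  have h := (cth_summable (s := ((1 / t : ℝ) : ℂ)) (by simpa using ht) 0).norm
  refine h.congr ?_
  intro k
  have := term_norm ((1 / t : ℝ) : ℂ) k
  simp only [ofReal_zero, sub_zero]
  rw [ofReal_intCast] at this
  rw [this]
  congr 1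
  rw [ofReal_re]
  ring

lemma theta_zero (t : ℝ) : theta (1 / t) 0 = ∑' k : ℤ, Real.exp (-π * (k:ℝ) ^ 2 / t) := by
  unfold theta
  apply tsum_congr; intro k; congr 1; ring

lemma theta_pos {t : ℝ} (ht : 0 < t) : 0 < theta (1 / t) 0 := by
  rw [theta_zero]
  exact (exp_summable ht).tsum_pos (fun _ => (Real.exp_pos _).le) 0 (Real.exp_pos _)

lemma qq_nonneg {t : ℝ} (ht : 0 < t) (k : ℤ) : 0 ≤ qq t k := by
  have := theta_pos ht
  unfold qq; positivity

lemma qq_summable {t : ℝ} (ht : 0 < t) : Summable (qq t) := (exp_summable ht).mul_left _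

lemma qq_sum {t : ℝ} (ht : 0 < t) : ∑' k, qq t k = 1 := by
  unfold qq
  rw [tsum_mul_left, ← theta_zero]
  exact inv_mul_cancel₀ (theta_pos ht).ne'

lemma qq_four {t : ℝ} (ht : 0 < t) (x : ℝ) :
    ∑' k : ℤ, (qq t k : ℂ) * cexp (2 * π * I * k * x) = cth t x / cth t 0 := by
  have h1 := poisson ht x
  have h0 := poisson ht 0
  simp only [ofReal_zero, mul_zero, Complex.exp_zero, mul_one] at h0
  have h2 : ((theta (1 / t) 0 : ℝ) : ℂ) = ∑' k : ℤ, cexp (-π * (k:ℂ) ^ 2 / t) := by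
    rw [theta_zero, ofReal_tsum]
    apply tsum_congr; intro k; push_cast; rfl
  have h3 : (1 / (((1 / t : ℝ)) : ℂ) ^ (1 / 2 : ℂ)) ≠ 0 := by
    intro h
    rw [← h2, h, zero_mul] at h0
    exact (theta_pos ht).ne' (by exact_mod_cast h0)
  calc _ = ∑' k : ℤ, ((theta (1 / t) 0 : ℝ) : ℂ)⁻¹ * (cexp (-π * (k:ℂ) ^ 2 / t) * cexp (2 * π * I * k * x)) := by
        apply tsum_congr; intro k; unfold qq; push_cast; ring
    _ = _ := by
        rw [tsum_mul_left, h1, h2, h0, ← div_eq_inv_mul]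
        exact mul_div_mul_left _ _ h3

lemma gauss_nonneg {d : ℕ} {t : ℝ} (ht : 0 < t) (n : Fin d → ℤ) : 0 ≤ gauss d t n := by
  rw [gauss_eq]; exact Finset.prod_nonneg (fun j _ => qq_nonneg ht _)

lemma qq_norm {t : ℝ} (ht : 0 < t) : Summable (fun k => ‖(qq t k : ℂ)‖) := by
  refine (qq_summable ht).congr ?_
  intro k; rw [Complex.norm_real, Real.norm_of_nonneg (qq_nonneg ht k)]

lemma gauss_hasSum {d : ℕ} {t : ℝ} (ht : 0 < t) : HasSum (gauss d t) 1 := by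
  obtain ⟨h1, h2⟩ := pi_sum d (fun _ k => (qq t k : ℂ)) (fun _ => qq_norm ht)
  have e : ∀ n : Fin d → ℤ, ∏ j, (qq t (n j) : ℂ) = ((gauss d t n : ℝ) : ℂ) := by
    intro n; rw [gauss_eq]; push_cast; rfl
  simp_rw [e] at h1 h2
  have h3 := h1.of_norm.hasSum
  rw [h2] at h3
  have e2 : (∏ j : Fin d, ∑' k, (qq t k : ℂ)) = ((1:ℝ):ℂ) := by
    rw [← ofReal_tsum, qq_sum ht]; simp
  rw [e2] at h3
  exact Complex.hasSum_ofReal.1 h3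

noncomputable def ee {d : ℕ} (n : Fin d → ℤ) (ξ : Fin d → ℝ) : ℂ := ∏ j, cexp (2 * π * I * n j * ξ j)

lemma exp_norm_one (k : ℤ) (x : ℝ) : ‖cexp (2 * π * I * k * x)‖ = 1 := by
  have : (2 * π * I * k * x : ℂ) = ((2 * π * k * x : ℝ) : ℂ) * I := by push_cast; ring
  rw [this, norm_exp_ofReal_mul_I]

lemma ee_norm {d : ℕ} (n : Fin d → ℤ) (ξ : Fin d → ℝ) : ‖ee n ξ‖ = 1 := by
  unfold ee
  rw [norm_prod]
  exact Finset.prod_eq_one (fun j _ => exp_norm_one _ _)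

lemma ee_add {d : ℕ} (n m : Fin d → ℤ) (ξ : Fin d → ℝ) : ee (n + m) ξ = ee n ξ * ee m ξ := by
  unfold ee
  rw [← Finset.prod_mul_distrib]
  apply Finset.prod_congr rfl
  intro j _
  rw [← Complex.exp_add]; congr 1; simp; ring

lemma ee_conj {d : ℕ} (n : Fin d → ℤ) (ξ : Fin d → ℝ) : (starRingEnd ℂ) (ee n ξ) = ee (-n) ξ := by
  unfold ee
  rw [map_prod]
  apply Finset.prod_congr rfl
  intro j _
  rw [← Complex.exp_conj]; congr 1
  have h2 : (starRingEnd ℂ) 2 = 2 := Complex.conj_ofNat 2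
  simp [h2]

lemma ee_cont {d : ℕ} (n : Fin d → ℤ) : Continuous (ee n) := by
  unfold ee; fun_prop

lemma gauss_four {d : ℕ} {t : ℝ} (ht : 0 < t) (ξ : Fin d → ℝ) :
    HasSum (fun n => (gauss d t n : ℂ) * ee n ξ) (mult ξ t) := by
  obtain ⟨h1, h2⟩ := pi_sum d (fun j k => (qq t k : ℂ) * cexp (2 * π * I * k * ξ j)) (fun j => by
    simpa only [norm_mul, exp_norm_one, mul_one] using qq_norm ht)
  have e : ∀ n : Fin d → ℤ, ∏ j, ((qq t (n j) : ℂ) * cexp (2 * π * I * n j * ξ j)) = (gauss d t n : ℂ) * ee n ξ := by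
    intro n; rw [gauss_eq, ee, Finset.prod_mul_distrib]; push_cast; rfl
  simp_rw [e, qq_four ht] at h1 h2
  have h3 := h1.of_norm.hasSum
  rw [h2] at h3
  exact h3

noncomputable def mu (d : ℕ) : Measure (Fin d → ℝ) :=
  Measure.pi (fun _ : Fin d => (volume : Measure ℝ).restrict (Set.Ioc 0 1))

instance probIoc : IsProbabilityMeasure ((volume : Measure ℝ).restrict (Set.Ioc 0 1)) :=
  ⟨by simp⟩

instance probMu (d : ℕ) : IsProbabilityMeasure (mu d) := by
  unfold mu; infer_instance

lemma int_exp (k : ℤ) : ∫ x : ℝ in Set.Ioc 0 1, cexp (2 * π * I * k * x) = if k = 0 then 1 else 0 := by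
  by_cases hk : k = 0
  · simp [hk]
  · rw [if_neg hk, ← intervalIntegral.integral_of_le zero_le_one]
    have hc : (2 * π * I * k : ℂ) ≠ 0 := by
      have := Real.pi_ne_zero
      simp [hk, this]
    rw [integral_exp_mul_complex hc]
    have : (2 * π * I * k * ((1:ℝ):ℂ) : ℂ) = k * (2 * π * I) := by push_cast; ring
    rw [this, Complex.exp_int_mul_two_pi_mul_I]
    simp

lemma int_ee {d : ℕ} (n : Fin d → ℤ) : ∫ ξ, ee n ξ ∂(mu d) = if n = 0 then 1 else 0 := by
  unfold ee mu
  rw [integral_fintype_prod_eq_prod (fun j (x : ℝ) => cexp (2 * π * I * n j * x))]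
  simp_rw [int_exp]
  by_cases h : n = 0
  · simp [h]
  · rw [if_neg h]
    obtain ⟨j, hj⟩ := Function.ne_iff.1 h
    exact Finset.prod_eq_zero (Finset.mem_univ j) (by simpa using hj)

lemma ee_int {d : ℕ} (n : Fin d → ℤ) : Integrable (ee n) (mu d) :=
  Integrable.of_bound (ee_cont n).aestronglyMeasurable 1 (Filter.Eventually.of_forall fun ξ => (ee_norm n ξ).le)

/-- Fourier coefficient -/
lemma four_coeff {d : ℕ} (K : (Fin d → ℤ) → ℂ) (hK : Summable (fun n => ‖K n‖))
    (M : (Fin d → ℝ) → ℂ) (hM : ∀ ξ, HasSum (fun n => K n * ee n ξ) (M ξ)) (m : Fin d → ℤ) :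
    ∫ ξ, M ξ * ee (-m) ξ ∂(mu d) = K m := by
  have h1 : ∀ ξ, M ξ * ee (-m) ξ = ∑' n, K n * ee (n - m) ξ := by
    intro ξ
    rw [← (hM ξ).tsum_eq, ← tsum_mul_right]
    apply tsum_congr; intro n
    rw [sub_eq_add_neg, ee_add]; ring
  simp_rw [h1]
  have h2 := hasSum_integral_of_summable_integral_norm (μ := mu d)
    (F := fun n ξ => K n * ee (n - m) ξ) (fun n => (ee_int _).const_mul _) (by
      simp only [norm_mul, ee_norm, mul_one]
      simpa using hK)
  rw [← h2.tsum_eq]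
  simp_rw [integral_const_mul, int_ee]
  rw [tsum_eq_single m]
  · simp
  · intro n hn
    simp [sub_eq_zero, hn]

lemma trig_cont {d : ℕ} (S : Finset (Fin d → ℤ)) (u : (Fin d → ℤ) → ℂ) :
    Continuous (fun ξ => ∑ y ∈ S, u y * ee y ξ) := by
  have := fun n : Fin d → ℤ => ee_cont n
  fun_prop

lemma trig_bound {d : ℕ} (S : Finset (Fin d → ℤ)) (u : (Fin d → ℤ) → ℂ) (ξ : Fin d → ℝ) :
    ‖∑ y ∈ S, u y * ee y ξ‖ ≤ ∑ y ∈ S, ‖u y‖ := by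
  refine (norm_sum_le _ _).trans (le_of_eq ?_)
  simp [ee_norm]

lemma parseval {d : ℕ} (S : Finset (Fin d → ℤ)) (u : (Fin d → ℤ) → ℂ) :
    ∫ ξ, ‖∑ y ∈ S, u y * ee y ξ‖ ^ 2 ∂(mu d) = ∑ y ∈ S, ‖u y‖ ^ 2 := by
  have h : ∀ ξ, ((‖∑ y ∈ S, u y * ee y ξ‖ ^ 2 : ℝ) : ℂ) =
      ∑ y ∈ S, ∑ z ∈ S, (u y * (starRingEnd ℂ) (u z)) * ee (y - z) ξ := by
    intro ξ
    rw [ofReal_pow, ← Complex.mul_conj', map_sum, Finset.sum_mul_sum]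
    apply Finset.sum_congr rfl; intro y _
    apply Finset.sum_congr rfl; intro z _
    rw [map_mul, ee_conj, sub_eq_add_neg, ee_add]; ring
  have h2 : ((∫ ξ, ‖∑ y ∈ S, u y * ee y ξ‖ ^ 2 ∂(mu d) : ℝ) : ℂ) = ((∑ y ∈ S, ‖u y‖ ^ 2 : ℝ) : ℂ) := by
    rw [← integral_complex_ofReal]
    simp_rw [h]
    rw [integral_finsetSum _ (fun y _ => integrable_finsetSum _ (fun z _ => (ee_int _).const_mul _))]
    push_cast
    apply Finset.sum_congr rfl; intro y hy
    rw [integral_finsetSum _ (fun z _ => (ee_int _).const_mul _)]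
    simp_rw [integral_const_mul, int_ee, sub_eq_zero]
    simp [hy, Complex.mul_conj']
  exact_mod_cast h2

lemma bilin_l2 {d : ℕ} (K : (Fin d → ℤ) → ℂ) (hK : Summable (fun n => ‖K n‖))
    (M : (Fin d → ℝ) → ℂ) (hM : ∀ ξ, HasSum (fun n => K n * ee n ξ) (M ξ)) (ε : ℝ) (hε : 0 ≤ ε)
    (hMε : ∀ ξ, ‖M ξ‖ ≤ ε) (S Y : Finset (Fin d → ℤ)) (v u : (Fin d → ℤ) → ℂ) :
    ‖∑ x ∈ S, ∑ y ∈ Y, K (x - y) * u y * v x‖ ≤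
      ε * (∑ y ∈ Y, ‖u y‖ ^ 2) ^ (1 / 2 : ℝ) * (∑ x ∈ S, ‖v x‖ ^ 2) ^ (1 / 2 : ℝ) := by
  let U := fun ξ => ∑ y ∈ Y, u y * ee y ξ
  let W := fun ξ => ∑ x ∈ S, (starRingEnd ℂ) (v x) * ee x ξ
  have hMm : AEStronglyMeasurable M (mu d) := by
    have : Continuous M := by
      have e : M = fun ξ => ∑' n, K n * ee n ξ := by funext ξ; exact (hM ξ).tsum_eq.symm
      rw [e]
      apply continuous_tsum (fun n => (ee_cont n).const_mul _) hK
      intro n ξ; simp [ee_norm]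
    exact this.aestronglyMeasurable
  have hMi : ∀ m, Integrable (fun ξ => M ξ * ee m ξ) (mu d) := by
    intro m
    apply Integrable.of_bound (hMm.mul (ee_cont m).aestronglyMeasurable) ε
    refine Filter.Eventually.of_forall fun ξ => ?_
    rw [Pi.mul_apply, norm_mul, ee_norm, mul_one]; exact hMε ξ
  have key : ∑ x ∈ S, ∑ y ∈ Y, K (x - y) * u y * v x =
      ∫ ξ, M ξ * (U ξ * (starRingEnd ℂ) (W ξ)) ∂(mu d) := by
    have h : ∀ ξ, M ξ * (U ξ * (starRingEnd ℂ) (W ξ)) =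
        ∑ x ∈ S, ∑ y ∈ Y, (u y * v x) * (M ξ * ee (-(x - y)) ξ) := by
      intro ξ
      simp only [U, W]
      rw [map_sum, mul_comm (∑ y ∈ Y, _), Finset.sum_mul_sum, Finset.mul_sum]
      apply Finset.sum_congr rfl; intro x _
      rw [Finset.mul_sum]
      apply Finset.sum_congr rfl; intro y _
      have : -(x - y) = y + (-x) := by abel
      rw [map_mul, ee_conj, Complex.conj_conj, this, ee_add]; ring
    simp_rw [h]
    rw [integral_finsetSum _ (fun y _ => integrable_finsetSum _ (fun z _ => (hMi _).const_mul _))]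
    apply Finset.sum_congr rfl; intro x _
    rw [integral_finsetSum _ (fun z _ => (hMi _).const_mul _)]
    apply Finset.sum_congr rfl; intro y _
    rw [integral_const_mul, four_coeff K hK M hM]; ring
  rw [key]
  have hU : MemLp (fun ξ => ‖U ξ‖) (ENNReal.ofReal 2) (mu d) := by
    apply MemLp.norm
    exact MemLp.of_bound (trig_cont Y u).aestronglyMeasurable (∑ y ∈ Y, ‖u y‖)
      (Filter.Eventually.of_forall (trig_bound Y u))
  have hW : MemLp (fun ξ => ‖W ξ‖) (ENNReal.ofReal 2) (mu d) := by
    apply MemLp.norm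
    exact MemLp.of_bound (trig_cont S _).aestronglyMeasurable (∑ y ∈ S, ‖(starRingEnd ℂ) (v y)‖)
      (Filter.Eventually.of_forall (trig_bound S _))
  have hold := integral_mul_le_Lp_mul_Lq_of_nonneg (μ := mu d) (p := 2) (q := 2)
    Real.HolderConjugate.two_two (Filter.Eventually.of_forall fun ξ => norm_nonneg (U ξ))
    (Filter.Eventually.of_forall fun ξ => norm_nonneg (W ξ)) hU hW
  have pU : ∫ ξ, ‖U ξ‖ ^ (2:ℝ) ∂(mu d) = ∑ y ∈ Y, ‖u y‖ ^ 2 := by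
    rw [← parseval]; simp [U]
  have pW : ∫ ξ, ‖W ξ‖ ^ (2:ℝ) ∂(mu d) = ∑ y ∈ S, ‖v y‖ ^ 2 := by
    have := parseval S (fun x => (starRingEnd ℂ) (v x))
    simp only [RCLike.norm_conj] at this
    rw [← this]; simp [W]
  rw [pU, pW] at hold
  calc _ ≤ ∫ ξ, ε * (‖U ξ‖ * ‖W ξ‖) ∂(mu d) := by
        apply norm_integral_le_of_norm_le
        · have hcont : Continuous (fun ξ => ‖U ξ‖ * ‖W ξ‖) :=
            ((trig_cont Y u).norm).mul ((trig_cont S _).norm)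
          apply Integrable.const_mul
          apply Integrable.of_bound hcont.aestronglyMeasurable
            ((∑ y ∈ Y, ‖u y‖) * (∑ y ∈ S, ‖(starRingEnd ℂ) (v y)‖))
          refine Filter.Eventually.of_forall fun ξ => ?_
          rw [norm_mul, norm_norm, norm_norm]
          have := trig_bound Y u ξ
          have := trig_bound S (fun x => (starRingEnd ℂ) (v x)) ξ
          gcongr
        · refine Filter.Eventually.of_forall fun ξ => ?_
          rw [norm_mul, norm_mul, RCLike.norm_conj]
          gcongr
          exact hMε ξ
    _ ≤ _ := by
        rw [integral_const_mul, mul_assoc]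
        gcongr

end FourierPart

section RT
open Complex

lemma rt_aux {d : ℕ} (K : (Fin d → ℤ) → ℂ) (hK : Summable (fun n => ‖K n‖)) (A : ℝ)
    (hA : ∑' n, ‖K n‖ ≤ A)
    (M : (Fin d → ℝ) → ℂ) (hM : ∀ ξ, HasSum (fun n => K n * ee n ξ) (M ξ)) (ε : ℝ) (hε : 0 ≤ ε)
    (hMε : ∀ ξ, ‖M ξ‖ ≤ ε) (p : ℝ) (hp1 : 1 < p) (hp2 : p < 2) (S Y : Finset (Fin d → ℤ))
    (f h : (Fin d → ℤ) → ℂ) (hf : ∀ y ∈ Y, f y ≠ 0) (hh : ∀ x ∈ S, h x ≠ 0)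
    (hdef : ∀ x ∈ S, h x = ∑ y ∈ Y, K (x - y) * f y) :
    (∑ x ∈ S, ‖h x‖ ^ p) ^ (1 / p) ≤
      A ^ (1 - (2 - 2 / p)) * ε ^ (2 - 2 / p) * (∑ y ∈ Y, ‖f y‖ ^ p) ^ (1 / p) := by
  have hp0 : 0 < p := by linarith
  have hA0 : 0 ≤ A := le_trans (tsum_nonneg fun _ => norm_nonneg _) hA
  set θ : ℝ := 2 - 2 / p with hθ
  have hθp : p * θ = 2 * p - 2 := by rw [hθ]; field_simp
  have hθ0 : 0 < θ := by
    rw [hθ]; have : 2 / p < 2 := by rw [div_lt_iff₀ hp0]; linarith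
    linarith
  have hθ1 : θ < 1 := by
    rw [hθ]; have : 1 < 2 / p := by rw [lt_div_iff₀ hp0]; linarith
    linarith
  let u : ℂ → (Fin d → ℤ) → ℂ := fun z y => f y / ‖f y‖ * (‖f y‖ : ℂ) ^ (p * (1 - z / 2))
  let v : ℂ → (Fin d → ℤ) → ℂ := fun z x => (starRingEnd ℂ) (h x) / ‖h x‖ * (‖h x‖ : ℂ) ^ (p * z / 2)
  have hu : ∀ z, ∀ y ∈ Y, ‖u z y‖ = ‖f y‖ ^ (p * (1 - z.re / 2)) := by
    intro z y hy
    have h0 : 0 < ‖f y‖ := norm_pos_iff.2 (hf y hy)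
    simp only [u]
    rw [norm_mul, norm_div, norm_real, norm_norm, div_self h0.ne', one_mul,
      norm_cpow_eq_rpow_re_of_pos h0]
    congr 1
    simp
  have hv : ∀ z, ∀ x ∈ S, ‖v z x‖ = ‖h x‖ ^ (p * z.re / 2) := by
    intro z y hy
    have h0 : 0 < ‖h y‖ := norm_pos_iff.2 (hh y hy)
    simp only [v]
    rw [norm_mul, norm_div, norm_real, norm_norm, RCLike.norm_conj, div_self h0.ne', one_mul,
      norm_cpow_eq_rpow_re_of_pos h0]
    congr 1
    simp
  let F : ℂ → ℂ := fun z => ∑ x ∈ S, ∑ y ∈ Y, K (x - y) * u z y * v z x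
  set Φ := ∑ y ∈ Y, ‖f y‖ ^ p with hΦ
  set X := ∑ x ∈ S, ‖h x‖ ^ p with hX
  have hΦ0 : 0 ≤ Φ := Finset.sum_nonneg fun _ _ => by positivity
  have hX0 : 0 ≤ X := Finset.sum_nonneg fun _ _ => by positivity
  have hFθ : F θ = (X : ℂ) := by
    have hu' : ∀ y ∈ Y, u θ y = f y := by
      intro y hy
      have h0 : (‖f y‖ : ℂ) ≠ 0 := by simpa using hf y hy
      have : (p * (1 - (θ:ℂ) / 2) : ℂ) = 1 := by
        have : p * (1 - θ / 2) = 1 := by linarith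
        exact_mod_cast congrArg (fun x : ℝ => (x : ℂ)) this
      simp only [u]
      rw [this, cpow_one, div_mul_cancel₀ _ h0]
    simp only [F]
    rw [hX, ofReal_sum]
    apply Finset.sum_congr rfl
    intro x hx
    rw [← Finset.sum_mul, Finset.sum_congr rfl (fun y hy => by rw [hu' y hy]), ← hdef x hx]
    have h0 : 0 < ‖h x‖ := norm_pos_iff.2 (hh x hx)
    have h0' : (‖h x‖ : ℂ) ≠ 0 := by simpa using hh x hx
    have e : (p * (θ:ℂ) / 2 : ℂ) = ((p - 1 : ℝ) : ℂ) := by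
      have : p * θ / 2 = p - 1 := by linarith
      exact_mod_cast congrArg (fun x : ℝ => (x : ℂ)) this
    simp only [v]
    rw [e, ← ofReal_cpow h0.le, ← mul_assoc]
    rw [show h x * ((starRingEnd ℂ) (h x) / (‖h x‖:ℂ)) = (‖h x‖:ℂ) by
      rw [mul_div_assoc', Complex.mul_conj']; field_simp]
    rw [← ofReal_mul, Real.rpow_sub_one h0.ne']
    congr 1
    field_simp
  have hFb : ∀ z, ‖F z‖ ≤ ∑ x ∈ S, ∑ y ∈ Y, ‖K (x - y)‖ * ‖u z y‖ * ‖v z x‖ := by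
    intro z
    refine (norm_sum_le _ _).trans (Finset.sum_le_sum fun x _ => (norm_sum_le _ _).trans
      (Finset.sum_le_sum fun y _ => ?_))
    rw [norm_mul, norm_mul]
  have hdiff : Differentiable ℂ F := by
    apply Differentiable.fun_sum; intro x hx
    apply Differentiable.fun_sum; intro y hy
    have h0 : (‖f y‖ : ℂ) ≠ 0 := by simpa using hf y hy
    have h0' : (‖h x‖ : ℂ) ≠ 0 := by simpa using hh x hx
    apply Differentiable.mul
    · apply Differentiable.const_mul
      apply Differentiable.const_mul
      apply Differentiable.const_cpow
      · fun_prop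
      · exact Or.inl h0
    · apply Differentiable.const_mul
      apply Differentiable.const_cpow
      · fun_prop
      · exact Or.inl h0'
  have three := HadamardThreeLines.norm_le_interp_of_mem_verticalClosedStrip₀₁' F (z := (θ:ℂ))
    (a := A * Φ) (b := ε * Φ ^ (1 / 2 : ℝ) * X ^ (1 / 2 : ℝ))
    (by simp [HadamardThreeLines.verticalClosedStrip, hθ0.le, hθ1.le]) hdiff.diffContOnCl
    (by
      refine ⟨∑ x ∈ S, ∑ y ∈ Y, ‖K (x - y)‖ * (1 + ‖f y‖) ^ p * (1 + ‖h x‖) ^ p, ?_⟩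
      rintro _ ⟨z, hz, rfl⟩
      simp only [HadamardThreeLines.verticalClosedStrip, Set.mem_preimage, Set.mem_Icc] at hz
      refine (hFb z).trans (Finset.sum_le_sum fun x hx => Finset.sum_le_sum fun y hy => ?_)
      rw [hu z y hy, hv z x hx]
      have hb : ∀ a s : ℝ, 0 ≤ a → 0 ≤ s → s ≤ p → a ^ s ≤ (1 + a) ^ p := by
        intro a s ha hs hsp
        calc a ^ s ≤ (1 + a) ^ s := Real.rpow_le_rpow ha (by linarith) hs
          _ ≤ _ := Real.rpow_le_rpow_of_exponent_le (by linarith) hsp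
      have b1 := hb ‖f y‖ (p * (1 - z.re / 2)) (norm_nonneg _) (by
        have : 0 ≤ 1 - z.re / 2 := by linarith
        positivity) (by nlinarith)
      have b2 := hb ‖h x‖ (p * z.re / 2) (norm_nonneg _) (by
        have := hz.1
        positivity) (by nlinarith)
      gcongr)
    (by
      intro z hz
      simp only [Set.mem_preimage, Set.mem_singleton_iff] at hz
      refine (hFb z).trans ?_
      rw [Finset.sum_comm, hΦ, Finset.mul_sum]
      apply Finset.sum_le_sum
      intro y hy
      calc _ = ∑ x ∈ S, ‖K (x - y)‖ * ‖f y‖ ^ p := by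
            apply Finset.sum_congr rfl
            intro x hx
            rw [hu z y hy, hv z x hx, hz]; simp
        _ = (∑ x ∈ S, ‖K (x - y)‖) * ‖f y‖ ^ p := by rw [Finset.sum_mul]
        _ ≤ _ := by
            gcongr
            refine le_trans ?_ hA
            have hs : Summable (fun x => ‖K (x - y)‖) := (Equiv.subRight y).summable_iff.2 hK
            rw [← (Equiv.subRight y).tsum_eq (fun n => ‖K n‖)]
            exact hs.sum_le_tsum S (fun _ _ => norm_nonneg _))
    (by
      intro z hz
      simp only [Set.mem_preimage, Set.mem_singleton_iff] at hz
      refine (bilin_l2 K hK M hM ε hε hMε S Y (v z) (u z)).trans (le_of_eq ?_)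
      have s1 : ∑ y ∈ Y, ‖u z y‖ ^ 2 = Φ := by
        apply Finset.sum_congr rfl
        intro y hy
        rw [hu z y hy, hz, ← Real.rpow_natCast, ← Real.rpow_mul (norm_nonneg _)]
        congr 1; push_cast; ring
      have s2 : ∑ x ∈ S, ‖v z x‖ ^ 2 = X := by
        apply Finset.sum_congr rfl
        intro y hy
        rw [hv z y hy, hz, ← Real.rpow_natCast, ← Real.rpow_mul (norm_nonneg _)]
        congr 1; push_cast; ring
      rw [s1, s2])
  rw [hFθ, norm_real, Real.norm_of_nonneg hX0, ofReal_re] at three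
  rcases hX0.eq_or_lt with h0 | hXpos
  · rw [← h0, Real.zero_rpow (by positivity)]; positivity
  rw [Real.mul_rpow hA0 hΦ0, Real.mul_rpow (by positivity) (by positivity), Real.mul_rpow hε (by positivity),
    ← Real.rpow_mul hΦ0, ← Real.rpow_mul hX0] at three
  have hpe : 1 / p = 1 - θ / 2 := by rw [hθ]; ring
  have hΦe : Φ ^ (1 / p) = Φ ^ (1 - θ) * Φ ^ (1 / 2 * θ) := by
    rw [← Real.rpow_add_of_nonneg hΦ0 (by linarith) (by linarith), hpe]; congr 1; ring
  have hXe : X = X ^ (1 / p) * X ^ (1 / 2 * θ) := by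
    rw [← Real.rpow_add hXpos, hpe]
    conv_lhs => rw [← Real.rpow_one X]
    congr 1; ring
  have hq : 0 < X ^ (1 / 2 * θ) := by positivity
  refine le_of_mul_le_mul_right ?_ hq
  rw [← hXe, hΦe]
  calc X ≤ _ := three
    _ = _ := by ring

lemma rt_fin {d : ℕ} (K : (Fin d → ℤ) → ℂ) (hK : Summable (fun n => ‖K n‖)) (A : ℝ)
    (hA : ∑' n, ‖K n‖ ≤ A)
    (M : (Fin d → ℝ) → ℂ) (hM : ∀ ξ, HasSum (fun n => K n * ee n ξ) (M ξ)) (ε : ℝ) (hε : 0 ≤ ε)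
    (hMε : ∀ ξ, ‖M ξ‖ ≤ ε) (p : ℝ) (hp1 : 1 < p) (hp2 : p < 2) (S Y : Finset (Fin d → ℤ))
    (f : (Fin d → ℤ) → ℂ) :
    (∑ x ∈ S, ‖∑ y ∈ Y, K (x - y) * f y‖ ^ p) ^ (1 / p) ≤
      A ^ (1 - (2 - 2 / p)) * ε ^ (2 - 2 / p) * (∑ y ∈ Y, ‖f y‖ ^ p) ^ (1 / p) := by
  classical
  have hp0 : p ≠ 0 := by linarith
  have h := rt_aux K hK A hA M hM ε hε hMε p hp1 hp2
    (S.filter (fun x => ∑ y ∈ Y, K (x - y) * f y ≠ 0)) (Y.filter (fun y => f y ≠ 0)) f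
    (fun x => ∑ y ∈ Y, K (x - y) * f y) (by simp) (by simp)
    (by
      intro x _
      rw [Finset.sum_filter_of_ne]
      intro y _ hy hf
      exact hy (by rw [hf, mul_zero]))
  rw [Finset.sum_filter_of_ne, Finset.sum_filter_of_ne] at h
  · exact h
  · intro y _ hy hf
    exact hy (by rw [hf, norm_zero, Real.zero_rpow hp0])
  · intro y _ hy hf
    exact hy (by rw [hf, norm_zero, Real.zero_rpow hp0])

end RT

lemma conv_sum {d : ℕ} {p : ℝ} (hp1 : 1 < p) (hp2 : p < 2) (K : (Fin d → ℤ) → ℂ)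
    (hK : Summable (fun n => ‖K n‖)) (A : ℝ) (hA : ∑' n, ‖K n‖ ≤ A)
    (M : (Fin d → ℝ) → ℂ) (hM : ∀ ξ, HasSum (fun n => K n * ee n ξ) (M ξ)) (ε : ℝ) (hε : 0 ≤ ε)
    (hMε : ∀ ξ, ‖M ξ‖ ≤ ε) (f : lp (fun _ : Fin d → ℤ => ℂ) (ENNReal.ofReal p))
    (g : (Fin d → ℤ) → ℂ) (hg : ∀ x, HasSum (fun n => K n * f (x - n)) (g x))
    (S : Finset (Fin d → ℤ)) :
    ∑ x ∈ S, ‖g x‖ ^ p ≤ (A ^ (1 - (2 - 2 / p)) * ε ^ (2 - 2 / p) * ‖f‖) ^ p := by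
  have hp0 : 0 < p := by linarith
  have htr : (ENNReal.ofReal p).toReal = p := ENNReal.toReal_ofReal hp0.le
  have hA0 : 0 ≤ A := le_trans (tsum_nonneg fun _ => norm_nonneg _) hA
  have hlim : Filter.Tendsto (fun Y : Finset (Fin d → ℤ) => ∑ x ∈ S, ‖∑ y ∈ Y, K (x - y) * f y‖ ^ p)
      Filter.atTop (nhds (∑ x ∈ S, ‖g x‖ ^ p)) := by
    apply tendsto_finsetSum
    intro x _
    apply Filter.Tendsto.rpow_const _ (Or.inr hp0.le)
    apply Filter.Tendsto.norm
    have := (Equiv.subLeft x).hasSum_iff.2 (hg x)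
    have e : ((fun n => K n * f (x - n)) ∘ (Equiv.subLeft x)) = fun y => K (x - y) * f y := by
      funext y; simp
    rw [e] at this
    exact this
  refine le_of_tendsto hlim (Filter.Eventually.of_forall fun Y => ?_)
  have h := rt_fin K hK A hA M hM ε hε hMε p hp1 hp2 S Y f
  have h0 : 0 ≤ ∑ x ∈ S, ‖∑ y ∈ Y, K (x - y) * f y‖ ^ p :=
    Finset.sum_nonneg fun _ _ => by positivity
  have hf : (∑ y ∈ Y, ‖f y‖ ^ p) ^ (1 / p) ≤ ‖f‖ := by
    have := lp.sum_rpow_le_norm_rpow (p := ENNReal.ofReal p) (by rw [htr]; exact hp0) f Y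
    rw [htr] at this
    calc _ ≤ (‖f‖ ^ p) ^ (1 / p) := Real.rpow_le_rpow (Finset.sum_nonneg fun _ _ => by positivity) this (by positivity)
      _ = ‖f‖ := by rw [one_div, Real.rpow_rpow_inv (lp.norm_nonneg' f) hp0.ne']
  calc _ = ((∑ x ∈ S, ‖∑ y ∈ Y, K (x - y) * f y‖ ^ p) ^ (1 / p)) ^ p := by
        rw [one_div, Real.rpow_inv_rpow h0 hp0.ne']
    _ ≤ _ := by
        apply Real.rpow_le_rpow (by positivity) _ hp0.le
        refine h.trans ?_
        gcongr

lemma conv_le {d : ℕ} {p : ℝ} (hp1 : 1 < p) (hp2 : p < 2) (K : (Fin d → ℤ) → ℂ)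
    (hK : Summable (fun n => ‖K n‖)) (A : ℝ) (hA : ∑' n, ‖K n‖ ≤ A)
    (M : (Fin d → ℝ) → ℂ) (hM : ∀ ξ, HasSum (fun n => K n * ee n ξ) (M ξ)) (ε : ℝ) (hε : 0 ≤ ε)
    (hMε : ∀ ξ, ‖M ξ‖ ≤ ε) (f g : lp (fun _ : Fin d → ℤ => ℂ) (ENNReal.ofReal p))
    (hg : ∀ x, HasSum (fun n => K n * f (x - n)) (g x)) :
    ‖g‖ ≤ A ^ (1 - (2 - 2 / p)) * ε ^ (2 - 2 / p) * ‖f‖ := by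
  have hp0 : 0 < p := by linarith
  have htr : (ENNReal.ofReal p).toReal = p := ENNReal.toReal_ofReal hp0.le
  have hA0 : 0 ≤ A := le_trans (tsum_nonneg fun _ => norm_nonneg _) hA
  have := lp.norm_nonneg' f
  apply lp.norm_le_of_forall_sum_le (by rw [htr]; exact hp0) (by positivity)
  intro S
  rw [htr]
  exact conv_sum hp1 hp2 K hK A hA M hM ε hε hMε f g hg S

lemma mult_real_le {d : ℕ} (ξ : Fin d → ℝ) {s : ℝ} (hs : 16 ≤ s) : ‖mult ξ (s:ℂ)‖ ≤ 1 := by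
  obtain ⟨h1, h2⟩ := strip_mem hs (z := (s:ℂ)) (by simp; linarith) (by simp; linarith)
  exact mult_le ξ h1 h2

lemma gauss_normsum {d : ℕ} {s : ℝ} (hs : 0 < s) : HasSum (fun n => ‖(gauss d s n : ℂ)‖) 1 := by
  have e : (fun n => ‖(gauss d s n : ℂ)‖) = gauss d s := by
    funext n; rw [Complex.norm_real, Real.norm_of_nonneg (gauss_nonneg hs n)]
  rw [e]; exact gauss_hasSum hs

lemma gConv_hasSum {d : ℕ} {p : ℝ} (hp1 : 1 < p) {s : ℝ} (hs : 0 < s)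
    (f : lp (fun _ : Fin d → ℤ => ℂ) (ENNReal.ofReal p)) (x : Fin d → ℤ) :
    HasSum (fun n => (gauss d s n : ℂ) * f (x - n)) (gConv d s f x) := by
  apply Summable.hasSum
  apply Summable.of_norm_bounded ((gauss_normsum hs).summable.mul_right ‖f‖)
  intro n
  rw [norm_mul]
  gcongr
  exact lp.norm_apply_le_norm (by simp; linarith) f _

lemma gConv_mem {d : ℕ} {p : ℝ} (hp1 : 1 < p) (hp2 : p < 2) {s : ℝ} (hs : 16 ≤ s)
    (f : lp (fun _ : Fin d → ℤ => ℂ) (ENNReal.ofReal p)) :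
    Memℓp (gConv d s f) (ENNReal.ofReal p) := by
  have htr : (ENNReal.ofReal p).toReal = p := ENNReal.toReal_ofReal (by linarith)
  apply memℓp_gen' (C := ((1:ℝ) ^ (1 - (2 - 2 / p)) * 1 ^ (2 - 2 / p) * ‖f‖) ^ p)
  intro S
  rw [htr]
  exact conv_sum hp1 hp2 (fun n => (gauss d s n : ℂ)) (gauss_normsum (by linarith)).summable 1
    (gauss_normsum (by linarith)).tsum_eq.le (fun ξ => mult ξ s) (gauss_four (by linarith)) 1 zero_le_one
    (fun ξ => mult_real_le ξ hs) f _ (gConv_hasSum hp1 (by linarith) f) S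

open Classical in
noncomputable def GG {d : ℕ} {p : ℝ} (hp1 : 1 < p) (hp2 : p < 2)
    (f : lp (fun _ : Fin d → ℤ => ℂ) (ENNReal.ofReal p)) (s : ℝ) :
    lp (fun _ : Fin d → ℤ => ℂ) (ENNReal.ofReal p) :=
  if hs : 16 ≤ s then ⟨gConv d s f, gConv_mem hp1 hp2 hs f⟩ else 0

lemma GG_apply {d : ℕ} {p : ℝ} (hp1 : 1 < p) (hp2 : p < 2)
    (f : lp (fun _ : Fin d → ℤ => ℂ) (ENNReal.ofReal p)) {s : ℝ} (hs : 16 ≤ s) (x : Fin d → ℤ) :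
    GG hp1 hp2 f s x = gConv d s f x := by
  rw [GG, dif_pos hs]

lemma fd_kernel {d : ℕ} {p : ℝ} (hp1 : 1 < p) (hp2 : p < 2)
    (f : lp (fun _ : Fin d → ℤ => ℂ) (ENNReal.ofReal p)) (w : ℝ) (hw : 0 ≤ w) (k : ℕ) :
    ∀ s : ℝ, 16 ≤ s → ∃ K : (Fin d → ℤ) → ℂ, Summable (fun n => ‖K n‖) ∧ ∑' n, ‖K n‖ ≤ 2 ^ k ∧
      (∀ ξ, HasSum (fun n => K n * ee n ξ) ((fwdDiff (w:ℂ))^[k] (mult ξ) s)) ∧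
      ∀ x, HasSum (fun n => K n * f (x - n)) ((fwdDiff w)^[k] (GG hp1 hp2 f) s x) := by
  induction k with
  | zero =>
    intro s hs
    refine ⟨fun n => gauss d s n, (gauss_normsum (by linarith)).summable,
      by rw [(gauss_normsum (by linarith)).tsum_eq]; simp, gauss_four (by linarith), ?_⟩
    intro x
    have := gConv_hasSum hp1 (by linarith) f x (s := s)
    rw [← GG_apply hp1 hp2 f hs] at this
    exact this
  | succ k ih =>
    intro s hs
    obtain ⟨K1, a1, b1, c1, d1⟩ := ih (s + w) (by linarith)
    obtain ⟨K2, a2, b2, c2, d2⟩ := ih s hs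
    have hle : ∀ n, ‖K1 n - K2 n‖ ≤ ‖K1 n‖ + ‖K2 n‖ := fun n => norm_sub_le _ _
    have hsum : Summable (fun n => ‖K1 n - K2 n‖) :=
      Summable.of_nonneg_of_le (fun _ => norm_nonneg _) hle (a1.add a2)
    refine ⟨fun n => K1 n - K2 n, hsum, ?_, ?_, ?_⟩
    · calc _ ≤ ∑' n, (‖K1 n‖ + ‖K2 n‖) := hsum.tsum_le_tsum hle (a1.add a2)
        _ = ∑' n, ‖K1 n‖ + ∑' n, ‖K2 n‖ := a1.tsum_add a2
        _ ≤ _ := by rw [pow_succ]; linarith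
    · intro ξ
      rw [Function.iterate_succ_apply', fwdDiff]
      have := (c1 ξ).sub (c2 ξ)
      push_cast at this
      simpa only [sub_mul] using this
    · intro x
      rw [Function.iterate_succ_apply', fwdDiff]
      have := (d1 x).sub (d2 x)
      simpa only [sub_mul, lp.coeFn_sub, Pi.sub_apply] using this

lemma lpNorm_eq {d : ℕ} {p : ℝ} (hp1 : 1 < p)
    (f : lp (fun _ : Fin d → ℤ => ℂ) (ENNReal.ofReal p)) :
    lpNorm d p (fun x => (‖f x‖₊ : ℝ≥0∞)) = ENNReal.ofReal ‖f‖ := by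
  have hp0 : 0 < p := by linarith
  have htr : (ENNReal.ofReal p).toReal = p := ENNReal.toReal_ofReal hp0.le
  have hs := (lp.memℓp f).summable (by rw [htr]; exact hp0)
  rw [lp.norm_eq_tsum_rpow (by rw [htr]; exact hp0)]
  rw [htr] at hs ⊢
  have h0 : ∀ x, 0 ≤ ‖f x‖ ^ p := fun x => by positivity
  rw [← ENNReal.ofReal_rpow_of_nonneg (tsum_nonneg h0) (by positivity),
    ENNReal.ofReal_tsum_of_nonneg h0 hs, lpNorm]
  congr 2
  funext x
  rw [← ENNReal.ofReal_rpow_of_nonneg (norm_nonneg _) hp0.le, ofReal_norm_eq_enorm]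
  rfl

lemma lpNorm_mem {d : ℕ} {p : ℝ} (hp1 : 1 < p) (f : (Fin d → ℤ) → ℂ)
    (hf : lpNorm d p (fun x => (‖f x‖₊ : ℝ≥0∞)) < ⊤) : Memℓp f (ENNReal.ofReal p) := by
  have hp0 : 0 < p := by linarith
  have htr : (ENNReal.ofReal p).toReal = p := ENNReal.toReal_ofReal hp0.le
  apply memℓp_gen
  rw [htr]
  rw [lpNorm, ENNReal.rpow_lt_top_iff_of_pos (by positivity)] at hf
  have h := ENNReal.summable_toReal hf.ne
  convert h using 1
  funext x
  rw [← ENNReal.toReal_rpow]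
  simp

lemma fd_bd {d : ℕ} {p : ℝ} (hp1 : 1 < p) (hp2 : p < 2) (α : ℝ) (hα0 : 0 < α)
    (k : ℕ) (hk : α ≤ k * (2 - 2 / p)) (t : ℝ) (ht : 16 ≤ t)
    (f : lp (fun _ : Fin d → ℤ => ℂ) (ENNReal.ofReal p)) (s : ℝ) (hs : t ≤ s) (w : ℝ) (hw : 0 < w) :
    ‖(fwdDiff w)^[k] (GG hp1 hp2 f) s‖ ≤
      (2 ^ k) ^ (1 - (2 - 2 / p)) * (4 ^ (k ^ 2) * 4 ^ k) ^ (2 - 2 / p) * (w / t) ^ α * ‖f‖ := by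
  have hp0 : 0 < p := by linarith
  have ht0 : 0 < t := by linarith
  set θ : ℝ := 2 - 2 / p with hθ
  have hθ0 : 0 < θ := by
    rw [hθ]; have : 2 / p < 2 := by rw [div_lt_iff₀ hp0]; linarith
    linarith
  obtain ⟨K, a, b, c, e⟩ := fd_kernel hp1 hp2 f w hw.le k s (by linarith)
  have hf0 := lp.norm_nonneg' f
  have hc1 : (2:ℝ) ^ k ≤ 4 ^ (k ^ 2) * 4 ^ k := by
    have h1 : (1:ℝ) ≤ 4 ^ (k ^ 2) := one_le_pow₀ (by norm_num)
    have h2 : (2:ℝ) ^ k ≤ 4 ^ k := by gcongr; norm_num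
    nlinarith [pow_pos (show (0:ℝ) < 2 by norm_num) k]
  have hr : 0 < w / t := by positivity
  rw [mul_assoc (((2:ℝ) ^ k) ^ (1 - θ))]
  rcases le_total (w / t) 1 with h | h
  · have H := conv_le hp1 hp2 K a _ b _ c (4 ^ (k ^ 2) * 4 ^ k * (w / t) ^ k) (by positivity)
      (fun ξ => by
        have := holo_diff k (mult ξ) t (t / 4) 1 w (by positivity) zero_le_one hw.le
          (fun z h1 h2 => mult_diff ξ (strip_mem ht h1 h2).1)
          (fun z h1 h2 => mult_le ξ (strip_mem ht h1 h2).1 (strip_mem ht h1 h2).2) s hs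
        refine this.trans (le_of_eq ?_)
        rw [one_mul, mul_assoc, ← mul_pow]
        congr 2
        field_simp) f _ e
    refine H.trans ?_
    gcongr
    rw [Real.mul_rpow (by positivity) (by positivity)]
    gcongr
    rw [← Real.rpow_natCast, ← Real.rpow_mul hr.le]
    exact Real.rpow_le_rpow_of_exponent_ge hr h hk
  · have H := conv_le hp1 hp2 K a _ b _ c (2 ^ k) (by positivity)
      (fun ξ => by
        rw [← (c ξ).tsum_eq]
        have hn : (fun n => ‖K n * ee n ξ‖) = fun n => ‖K n‖ := by
          funext n; rw [norm_mul, ee_norm, mul_one]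
        refine (norm_tsum_le_tsum_norm (by rw [hn]; exact a)).trans ?_
        rw [hn]; exact b) f _ e
    refine H.trans ?_
    gcongr
    calc ((2:ℝ) ^ k) ^ θ ≤ (4 ^ (k ^ 2) * 4 ^ k) ^ θ := by gcongr
      _ ≤ _ := le_mul_of_one_le_right (by positivity) (Real.one_le_rpow h hα0.le)


/-- Dimension-free Hölder-type ℓ^p bound for differences of the discrete Gaussian operators at
large scales: for each `p ∈ (1,2)` and `α ∈ (0,1)` there is `C(p,α) > 0`, independent of the
dimension `d`, with `‖G_{t+w} f - G_t f‖_{ℓ^p} ≤ C(p,α)(w/t)^α ‖f‖_{ℓ^p}` for `t ≥ 16`, `w > 0`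
and `f ∈ ℓ^p(ℤ^d)`. -/
theorem gauss_difference_lp (p : ℝ) (hp1 : 1 < p) (hp2 : p < 2)
    (α : ℝ) (hα0 : 0 < α) (hα1 : α < 1) :
    ∃ C : ℝ, 0 < C ∧ ∀ d : ℕ, 0 < d → ∀ t : ℝ, 16 ≤ t → ∀ w : ℝ, 0 < w →
      ∀ f : (Fin d → ℤ) → ℂ, lpNorm d p (fun x => (‖f x‖₊ : ℝ≥0∞)) < ⊤ →
      lpNorm d p (fun x => (‖gConv d (t + w) f x - gConv d t f x‖₊ : ℝ≥0∞))
        ≤ ENNReal.ofReal (C * (w / t) ^ α) * lpNorm d p (fun x => (‖f x‖₊ : ℝ≥0∞)) := by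
  have hp0 : 0 < p := by linarith
  have hθ0 : 0 < 2 - 2 / p := by
    have : 2 / p < 2 := by rw [div_lt_iff₀ hp0]; linarith
    linarith
  obtain ⟨m, hm⟩ := exists_nat_ge (α / (2 - 2 / p))
  have hk : α ≤ ((m + 1 : ℕ) : ℝ) * (2 - 2 / p) := by
    rw [div_le_iff₀ hθ0] at hm
    push_cast; linarith
  obtain ⟨C, hC, H⟩ := marchaud α hα1 m
  have hp' : Fact (1 ≤ ENNReal.ofReal p) := ⟨by
    rw [← ENNReal.ofReal_one]; exact ENNReal.ofReal_le_ofReal hp1.le⟩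
  set c : ℝ := (2 ^ (m + 1)) ^ (1 - (2 - 2 / p)) * (4 ^ ((m + 1) ^ 2) * 4 ^ (m + 1)) ^ (2 - 2 / p) with hc
  have hc0 : 0 < c := by positivity
  refine ⟨C * c, by positivity, ?_⟩
  intro d _ t ht w hw f0 hf0
  have ht0 : 0 < t := by linarith
  obtain ⟨f, rfl⟩ : ∃ f : lp (fun _ : Fin d → ℤ => ℂ) (ENNReal.ofReal p), f0 = f :=
    ⟨⟨f0, lpNorm_mem hp1 f0 hf0⟩, rfl⟩
  have key := H _ (GG hp1 hp2 f) t ‖f‖ (c * ‖f‖ / t ^ α) (by positivity)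
    (by
      intro s hs
      obtain ⟨K, a1, a2, a3, a4⟩ := fd_kernel hp1 hp2 f 0 le_rfl 0 s (by linarith)
      have := conv_le hp1 hp2 K a1 _ a2 _ a3 1 zero_le_one
        (fun ξ => mult_real_le ξ (by linarith)) f _ a4
      simpa using this)
    (by
      intro s hs h hh
      have := fd_bd hp1 hp2 α hα0 (m + 1) hk t ht f s hs h hh
      refine this.trans (le_of_eq ?_)
      rw [← hc, Real.div_rpow hh.le ht0.le]
      ring) t le_rfl w hw
  have e : (fun x => (‖gConv d (t + w) f x - gConv d t f x‖₊ : ℝ≥0∞)) =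
      fun x => (‖(GG hp1 hp2 f (t + w) - GG hp1 hp2 f t) x‖₊ : ℝ≥0∞) := by
    funext x
    rw [lp.coeFn_sub, Pi.sub_apply, GG_apply hp1 hp2 f ht, GG_apply hp1 hp2 f (by linarith)]
  rw [e, lpNorm_eq hp1, lpNorm_eq hp1, ← ENNReal.ofReal_mul (by positivity)]
  apply ENNReal.ofReal_le_ofReal
  refine key.trans (le_of_eq ?_)
  rw [Real.div_rpow hw.le ht0.le]
  ring
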